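/- Consider the partial 4 × 4 grid G over ℂ⁴ with rows (e₃, ·, e₁, e₄), (·, e₄, e₃, e₂), (e₁, e₂, e₄, e₃), (e₄, e₃, e₂, e₁), with empty cells at positions (1,2) and (2,1). Filling position (1,2) with x = (e₁ + e₂)/√2 and position (2,1) with y = (e₁ − e₂)/√2 yields a full square whose SudoQ error equals exactly 1: every one of the twelve constraint deviations ‖Σ_{cells in c} |v⟩⟨v| − I₄‖₂ is at most 1, and at least one of them equals 1. Combined with the lower bound 𝓔_q(G) ≥ 1, the quantum SudoQ score of G equals 1. -/

import Mathlib

/-- The rank-one projection `|v⟩⟨v|` as a matrix. -/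
noncomputable def proj {κ : Type*} [Fintype κ] (v : EuclideanSpace ℂ κ) : Matrix κ κ ℂ :=
  fun i j => v i * star (v j)

/-- The Frobenius norm `‖A‖₂ = √(Tr(A* A))`. -/
noncomputable def frobNorm {κ : Type*} [Fintype κ] (A : Matrix κ κ ℂ) : ℝ :=
  Real.sqrt (Matrix.trace (A.conjTranspose * A)).re

/-- The standard basis of `ℂ⁴`. -/
noncomputable def E (k : Fin 4) : EuclideanSpace ℂ (Fin 4) :=
  EuclideanSpace.single k 1

/-- The partial grid `G` with rows `(e₃, ·, e₁, e₄)`, `(·, e₄, e₃, e₂)`,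
`(e₁, e₂, e₄, e₃)`, `(e₄, e₃, e₂, e₁)`, completed by placing the unit vector `x`
at position `(1,2)` and `y` at position `(2,1)` (1-indexed). -/
noncomputable def Gsq (x y : EuclideanSpace ℂ (Fin 4)) :
    Fin 4 → Fin 4 → EuclideanSpace ℂ (Fin 4) :=
  ![![E 2, x, E 0, E 3],
    ![y, E 3, E 2, E 1],
    ![E 0, E 1, E 3, E 2],
    ![E 3, E 2, E 1, E 0]]

/-- The twelve SudoQ constraints of a `4 × 4` grid: four rows, four columns, and
four `2 × 2` blocks, each given as the list of its four cells. -/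
def constraints : Fin 12 → Fin 4 → Fin 4 × Fin 4 :=
  ![fun j => (0, j), fun j => (1, j), fun j => (2, j), fun j => (3, j),
    fun i => (i, 0), fun i => (i, 1), fun i => (i, 2), fun i => (i, 3),
    ![(0, 0), (0, 1), (1, 0), (1, 1)], ![(0, 2), (0, 3), (1, 2), (1, 3)],
    ![(2, 0), (2, 1), (3, 0), (3, 1)], ![(2, 2), (2, 3), (3, 2), (3, 3)]]

/-- The deviation of the square `M` from constraint `c`:
`‖ Σ_{cells in c} |v⟩⟨v| − I₄ ‖₂`. -/
noncomputable def dev (M : Fin 4 → Fin 4 → EuclideanSpace ℂ (Fin 4)) (c : Fin 12) : ℝ :=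
  frobNorm ((∑ t : Fin 4, proj (M (constraints c t).1 (constraints c t).2)) - 1)

/-- The SudoQ error of a full square: the maximum deviation over the twelve
constraints. -/
noncomputable def sudoqError (M : Fin 4 → Fin 4 → EuclideanSpace ℂ (Fin 4)) : ℝ :=
  Finset.univ.sup' Finset.univ_nonempty (dev M)

theorem proj_basis_sum : proj (E 0) + proj (E 1) + proj (E 2) + proj (E 3) = 1 := by
  ext i j
  fin_cases i <;> fin_cases j <;> simp [proj, E]

theorem sum_normSq_of_norm_eq_one {κ : Type*} [Fintype κ] {x : EuclideanSpace ℂ κ}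
    (hx : ‖x‖ = 1) : ∑ i, Complex.normSq (x i) = 1 := by
  have h := EuclideanSpace.norm_sq_eq x
  rw [hx, one_pow] at h
  simp [Complex.normSq_eq_norm_sq, ← h]

theorem frobNorm_zero {κ : Type*} [Fintype κ] : frobNorm (0 : Matrix κ κ ℂ) = 0 := by
  simp [frobNorm]

/-- The projections onto two unit vectors, one of them a basis vector, are at distance
`√(2 - 2|⟨e_k, x⟩|²)`. -/
theorem frobNorm_proj_sub_basis {x : EuclideanSpace ℂ (Fin 4)} (hx : ‖x‖ = 1) (k : Fin 4) :
    frobNorm (proj x - proj (E k)) = Real.sqrt (2 - 2 * Complex.normSq (x k)) := by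
  have h := sum_normSq_of_norm_eq_one hx
  have h2 : (∑ i, Complex.normSq (x i)) ^ 2 = 1 := by rw [h, one_pow]
  unfold frobNorm
  congr 1
  simp only [Fin.sum_univ_four, Complex.normSq_apply] at h h2
  simp only [Matrix.trace, Matrix.diag, Matrix.mul_apply, Matrix.conjTranspose_apply,
    Fin.sum_univ_four, Matrix.sub_apply, proj, Complex.normSq_apply]
  fin_cases k <;> simp [E] <;> linear_combination h2

theorem norm_smul_add_basis : ‖((Real.sqrt 2 : ℂ))⁻¹ • (E 0 + E 1)‖ = 1 := by
  rw [EuclideanSpace.norm_eq, Real.sqrt_eq_one]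
  simp [Fin.sum_univ_four, E]
  norm_num

theorem norm_smul_sub_basis : ‖((Real.sqrt 2 : ℂ))⁻¹ • (E 0 - E 1)‖ = 1 := by
  rw [EuclideanSpace.norm_eq, Real.sqrt_eq_one]
  simp [Fin.sum_univ_four, E]
  norm_num

theorem proj_smul_add_proj_smul_sub :
    proj (((Real.sqrt 2 : ℂ))⁻¹ • (E 0 + E 1)) + proj (((Real.sqrt 2 : ℂ))⁻¹ • (E 0 - E 1)) =
      proj (E 0) + proj (E 1) := by
  have h : ((Real.sqrt 2 : ℂ))⁻¹ * ((Real.sqrt 2 : ℂ))⁻¹ = 1 / 2 := by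
    rw [← mul_inv, ← Complex.ofReal_mul, Real.mul_self_sqrt (by norm_num)]
    norm_num
  ext i j
  fin_cases i <;> fin_cases j <;> simp [proj, E, h] <;> norm_num

section Deviations

variable (x y : EuclideanSpace ℂ (Fin 4))

theorem dev_Gsq_first_row : dev (Gsq x y) 0 = frobNorm (proj x - proj (E 1)) := by
  simp only [dev, ← proj_basis_sum, Fin.sum_univ_four]
  congr 1
  simp [constraints, Gsq]
  abel

theorem dev_Gsq_second_row : dev (Gsq x y) 1 = frobNorm (proj y - proj (E 0)) := by
  simp only [dev, ← proj_basis_sum, Fin.sum_univ_four]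
  congr 1
  simp [constraints, Gsq]
  abel

theorem dev_Gsq_first_column : dev (Gsq x y) 4 = frobNorm (proj y - proj (E 1)) := by
  simp only [dev, ← proj_basis_sum, Fin.sum_univ_four]
  congr 1
  simp [constraints, Gsq]
  abel

theorem dev_Gsq_second_column : dev (Gsq x y) 5 = frobNorm (proj x - proj (E 0)) := by
  simp only [dev, ← proj_basis_sum, Fin.sum_univ_four]
  congr 1
  simp [constraints, Gsq]
  abel

theorem dev_Gsq_first_block :
    dev (Gsq x y) 8 = frobNorm (proj x + proj y - (proj (E 0) + proj (E 1))) := by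
  simp only [dev, ← proj_basis_sum, Fin.sum_univ_four]
  congr 1
  simp [constraints, Gsq]
  abel

theorem dev_Gsq_of_filled (c : Fin 12) (hc : c ∉ ({0, 1, 4, 5, 8} : Finset (Fin 12))) :
    dev (Gsq x y) c = 0 := by
  rw [← frobNorm_zero (κ := Fin 4)]
  simp only [dev, ← proj_basis_sum, Fin.sum_univ_four]
  congr 1
  fin_cases c <;> first | (exact absurd hc (by decide)) | (simp [constraints, Gsq]; abel)

theorem dev_le_sudoqError (M : Fin 4 → Fin 4 → EuclideanSpace ℂ (Fin 4)) (c : Fin 12) :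
    dev M c ≤ sudoqError M :=
  Finset.le_sup' (dev M) (Finset.mem_univ c)

theorem one_le_sudoqError_Gsq {x : EuclideanSpace ℂ (Fin 4)} (hx : ‖x‖ = 1) :
    1 ≤ sudoqError (Gsq x y) := by
  have h := sum_normSq_of_norm_eq_one hx
  rw [Fin.sum_univ_four] at h
  have hrow := dev_le_sudoqError (Gsq x y) 0
  have hcol := dev_le_sudoqError (Gsq x y) 5
  rw [dev_Gsq_first_row, frobNorm_proj_sub_basis hx] at hrow
  rw [dev_Gsq_second_column, frobNorm_proj_sub_basis hx] at hcol
  rcases le_total (Complex.normSq (x 0)) (1 / 2) with h0 | h0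
  · exact (Real.one_le_sqrt.2 (by linarith)).trans hcol
  · exact (Real.one_le_sqrt.2 (by
      linarith [Complex.normSq_nonneg (x 2), Complex.normSq_nonneg (x 3)])).trans hrow

end Deviations

/-- Filling position `(1,2)` of `G` with `x = (e₁+e₂)/√2` and position `(2,1)` with
`y = (e₁−e₂)/√2` yields a full square whose SudoQ error equals exactly 1: every one
of the twelve constraint deviations is at most 1, and at least one equals 1.
Combined with the lower bound `𝓔_q(G) ≥ 1`, the quantum SudoQ score of `G` is 1. -/
theorem sudoq_score_eq_one :
    (∀ c : Fin 12,
      dev (Gsq (((Real.sqrt 2 : ℂ))⁻¹ • (E 0 + E 1)) (((Real.sqrt 2 : ℂ))⁻¹ • (E 0 - E 1))) c ≤ 1) ∧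
    (∃ c : Fin 12,
      dev (Gsq (((Real.sqrt 2 : ℂ))⁻¹ • (E 0 + E 1)) (((Real.sqrt 2 : ℂ))⁻¹ • (E 0 - E 1))) c = 1) ∧
    sudoqError (Gsq (((Real.sqrt 2 : ℂ))⁻¹ • (E 0 + E 1)) (((Real.sqrt 2 : ℂ))⁻¹ • (E 0 - E 1))) = 1 ∧
    sInf {r : ℝ | ∃ x y : EuclideanSpace ℂ (Fin 4),
      ‖x‖ = 1 ∧ ‖y‖ = 1 ∧ r = sudoqError (Gsq x y)} = 1 := by
  set x : EuclideanSpace ℂ (Fin 4) := ((Real.sqrt 2 : ℂ))⁻¹ • (E 0 + E 1) with hx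
  set y : EuclideanSpace ℂ (Fin 4) := ((Real.sqrt 2 : ℂ))⁻¹ • (E 0 - E 1) with hy
  have nx : ‖x‖ = 1 := norm_smul_add_basis
  have ny : ‖y‖ = 1 := norm_smul_sub_basis
  have x0 : Complex.normSq (x 0) = 1 / 2 := by simp [hx, E]
  have x1 : Complex.normSq (x 1) = 1 / 2 := by simp [hx, E]
  have y0 : Complex.normSq (y 0) = 1 / 2 := by simp [hy, E]
  have y1 : Complex.normSq (y 1) = 1 / 2 := by simp [hy, E]
  have d0 : dev (Gsq x y) 0 = 1 := by
    rw [dev_Gsq_first_row, frobNorm_proj_sub_basis nx, x1]; norm_num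
  have d1 : dev (Gsq x y) 1 = 1 := by
    rw [dev_Gsq_second_row, frobNorm_proj_sub_basis ny, y0]; norm_num
  have d4 : dev (Gsq x y) 4 = 1 := by
    rw [dev_Gsq_first_column, frobNorm_proj_sub_basis ny, y1]; norm_num
  have d5 : dev (Gsq x y) 5 = 1 := by
    rw [dev_Gsq_second_column, frobNorm_proj_sub_basis nx, x0]; norm_num
  have d8 : dev (Gsq x y) 8 = 0 := by
    rw [dev_Gsq_first_block, proj_smul_add_proj_smul_sub, sub_self, frobNorm_zero]
  have hle : ∀ c, dev (Gsq x y) c ≤ 1 := by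
    intro c
    by_cases hc : c ∈ ({0, 1, 4, 5, 8} : Finset (Fin 12))
    · simp only [Finset.mem_insert, Finset.mem_singleton] at hc
      rcases hc with rfl | rfl | rfl | rfl | rfl <;> simp [d0, d1, d4, d5, d8]
    · simp [dev_Gsq_of_filled x y c hc]
  have herr : sudoqError (Gsq x y) = 1 :=
    le_antisymm (Finset.sup'_le _ _ fun c _ => hle c) (one_le_sudoqError_Gsq y nx)
  refine ⟨hle, ⟨0, d0⟩, herr, ?_⟩
  refine IsLeast.csInf_eq ⟨⟨x, y, nx, ny, herr.symm⟩, ?_⟩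
  rintro r ⟨u, v, hu, -, rfl⟩
  exact one_le_sudoqError_Gsq v hu
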